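/- arXiv:2412.19939 — 2 statements merged into one kernel-verified Lean document; each statement's English description precedes it below -/
import Mathlib

section
/- Under the radial gradient extended Ricci soliton coordinate setting, for every x ∈ ℝⁿ with r = ‖x‖ > 0 and every index i, the left-hand side of the diagonal soliton equation at x, namely (n−2)·F_{x_i x_i}/F + Σ_k F_{x_k x_k}/F − (n−1)·Σ_k F_{x_k}²/F² + f_{x_i x_i} + 2·(F_{x_i}/F)·f_{x_i} − Σ_k (F_{x_k}/F)·f_{x_k} − αₙ·w_{x_i}², equals xᵢ²·B(r) + (2n−3)·𝔉'(r)/(r·𝔉(r)) + 𝔣'(r)/r + 𝔉''(r)/𝔉(r) − (n−1)·(𝔉'(r)/𝔉(r))² − (𝔉'(r)/𝔉(r))·𝔣'(r), where B(r) := ((n−2)/𝔉(r))·( 𝔉''(r)/r² − 𝔉'(r)/r³ ) + 𝔣''(r)/r² − 𝔣'(r)/r³ + 2·𝔉'(r)·𝔣'(r)/(𝔉(r)·r²) − αₙ·(𝔴'(r))²/r². In particular, if B(r) = 0, then the diagonal soliton equation holds at x for index i if and only if (2n−3)𝔉'(r)/(r𝔉(r)) + 𝔣'(r)/r + 𝔉''(r)/𝔉(r)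 − (n−1)(𝔉'(r)/𝔉(r))² − (𝔉'(r)/𝔉(r))𝔣'(r) = λ/𝔉(r)². -/
/-- The partial derivative of `h` at `x` along the `i`-th standard basis vector. -/
noncomputable def pd {n : ℕ} (h : EuclideanSpace ℝ (Fin n) → ℝ) (i : Fin n)
    (x : EuclideanSpace ℝ (Fin n)) : ℝ :=
  fderiv ℝ h x (EuclideanSpace.single i 1)

/-- The iterated partial derivative, first along the `i`-th and then along the
`j`-th standard basis vector. -/
noncomputable def pd2 {n : ℕ} (h : EuclideanSpace ℝ (Fin n) → ℝ) (i j : Fin n)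
    (x : EuclideanSpace ℝ (Fin n)) : ℝ :=
  pd (pd h i) j x

/-- The radial quantity `B(r)` appearing in the off-diagonal soliton equation. -/
noncomputable def B (n : ℕ) (𝓕 𝓯 𝔀 : ℝ → ℝ) (r : ℝ) : ℝ :=
  ((n - 2 : ℝ) / 𝓕 r) * (deriv (deriv 𝓕) r / r ^ 2 - deriv 𝓕 r / r ^ 3)
    + deriv (deriv 𝓯) r / r ^ 2 - deriv 𝓯 r / r ^ 3
    + 2 * deriv 𝓕 r * deriv 𝓯 r / (𝓕 r * r ^ 2)
    - ((n - 1 : ℝ) / (n - 2 : ℝ)) * (deriv 𝔀 r) ^ 2 / r ^ 2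

/-- The radial quantity appearing in the diagonal soliton equation. -/
noncomputable def D (n : ℕ) (𝓕 𝓯 : ℝ → ℝ) (r : ℝ) : ℝ :=
  (2 * n - 3 : ℝ) * deriv 𝓕 r / (r * 𝓕 r) + deriv 𝓯 r / r
    + deriv (deriv 𝓕) r / 𝓕 r - (n - 1 : ℝ) * (deriv 𝓕 r / 𝓕 r) ^ 2
    - (deriv 𝓕 r / 𝓕 r) * deriv 𝓯 r

theorem hasFDerivAt_norm_aux {n : ℕ} (x : EuclideanSpace ℝ (Fin n)) (hx : 0 < ‖x‖) :
    HasFDerivAt (fun y : EuclideanSpace ℝ (Fin n) => ‖y‖) (‖x‖⁻¹ • innerSL ℝ x) x := by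
  have h1 : HasFDerivAt (fun y : EuclideanSpace ℝ (Fin n) => ‖y‖ ^ 2) (2 • innerSL ℝ x) x :=
    (hasStrictFDerivAt_norm_sq x).hasFDerivAt
  have h2 := h1.sqrt (by positivity)
  have h3 : (fun y : EuclideanSpace ℝ (Fin n) => √(‖y‖ ^ 2)) = fun y => ‖y‖ := by
    funext y
    exact Real.sqrt_sq (norm_nonneg y)
  rw [h3, Real.sqrt_sq (norm_nonneg x)] at h2
  have h4 : ‖x‖⁻¹ • innerSL ℝ x = (1 / (2 * ‖x‖)) • (2 : ℕ) • innerSL ℝ x := by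
    rw [← Nat.cast_smul_eq_nsmul ℝ, smul_smul]
    congr 1
    push_cast
    field_simp
  rw [h4]
  exact h2

theorem pd_radial {n : ℕ} (H : ℝ → ℝ) (hH : ContDiff ℝ 2 H)
    (h : EuclideanSpace ℝ (Fin n) → ℝ) (hh : ∀ x, h x = H ‖x‖)
    (x : EuclideanSpace ℝ (Fin n)) (hx : 0 < ‖x‖) (i : Fin n) :
    pd h i x = deriv H ‖x‖ * (‖x‖⁻¹ * x i) := by
  have e : h = fun y => H ‖y‖ := funext hh
  have hd : HasDerivAt H (deriv H ‖x‖) ‖x‖ :=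
    ((hH.differentiable (by norm_num)) _).hasDerivAt
  have h2 := hd.comp_hasFDerivAt x (hasFDerivAt_norm_aux x hx)
  have h3 : fderiv ℝ h x = deriv H ‖x‖ • ‖x‖⁻¹ • innerSL ℝ x := by
    rw [e]; exact h2.fderiv
  unfold pd
  rw [h3]
  simp [EuclideanSpace.inner_single_right]

theorem pd2_radial {n : ℕ} (H : ℝ → ℝ) (hH : ContDiff ℝ 2 H)
    (h : EuclideanSpace ℝ (Fin n) → ℝ) (hh : ∀ x, h x = H ‖x‖)
    (x : EuclideanSpace ℝ (Fin n)) (hx : 0 < ‖x‖) (i : Fin n) :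
    pd2 h i i x = x i ^ 2 * (deriv (deriv H) ‖x‖ / ‖x‖ ^ 2 - deriv H ‖x‖ / ‖x‖ ^ 3)
      + deriv H ‖x‖ / ‖x‖ := by
  have hev : pd h i =ᶠ[nhds x] fun y => deriv H ‖y‖ * (‖y‖⁻¹ * y i) := by
    filter_upwards [continuous_norm.continuousAt.eventually (lt_mem_nhds hx)] with y hy
    exact pd_radial H hH h hh y hy i
  have hd1 : ContDiff ℝ 1 (deriv H) := by
    have : ContDiff ℝ (1 + 1) H := by simpa [one_add_one_eq_two] using hH
    exact (contDiff_succ_iff_deriv.1 this).2.2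
  have hd : HasDerivAt (deriv H) (deriv (deriv H) ‖x‖) ‖x‖ :=
    ((hd1.differentiable (by norm_num)) _).hasDerivAt
  have hN := hasFDerivAt_norm_aux x hx
  have h2 := hd.comp_hasFDerivAt x hN
  have h3 := (hasDerivAt_inv hx.ne').comp_hasFDerivAt x hN
  have h4 : HasFDerivAt (fun y : EuclideanSpace ℝ (Fin n) => y i)
      (EuclideanSpace.proj i : EuclideanSpace ℝ (Fin n) →L[ℝ] ℝ) x :=
    (EuclideanSpace.proj i : EuclideanSpace ℝ (Fin n) →L[ℝ] ℝ).hasFDerivAt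
  have h5 := h2.mul (h3.mul h4)
  have h6 : fderiv ℝ (pd h i) x = _ := hev.fderiv_eq.trans h5.fderiv
  unfold pd2
  rw [pd, h6]
  simp [EuclideanSpace.inner_single_right]
  field_simp
  ring

theorem sum_sq_norm {n : ℕ} (x : EuclideanSpace ℝ (Fin n)) : ∑ k, x k ^ 2 = ‖x‖ ^ 2 := by
  rw [EuclideanSpace.norm_sq_eq]
  simp

/-- diagonal soliton equation for radial data. -/
theorem diag_soliton_radial (n : ℕ) (hn : 3 ≤ n) (lam : ℝ) (𝓕 𝓯 𝔀 : ℝ → ℝ)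
    (h𝓕 : ContDiff ℝ 2 𝓕) (h𝓯 : ContDiff ℝ 2 𝓯) (h𝔀 : ContDiff ℝ 2 𝔀)
    (h𝓕ne : ∀ r : ℝ, 0 < r → 𝓕 r ≠ 0)
    (F f w : EuclideanSpace ℝ (Fin n) → ℝ)
    (hF : ∀ x, F x = 𝓕 ‖x‖) (hf : ∀ x, f x = 𝓯 ‖x‖) (hw : ∀ x, w x = 𝔀 ‖x‖) :
    ∀ (x : EuclideanSpace ℝ (Fin n)), 0 < ‖x‖ → ∀ i : Fin n,
      ((n - 2 : ℝ) * pd2 F i i x / F x + (∑ k : Fin n, pd2 F k k x / F x)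
          - (n - 1 : ℝ) * (∑ k : Fin n, (pd F k x) ^ 2 / (F x) ^ 2)
          + pd2 f i i x + 2 * (pd F i x / F x) * pd f i x
          - (∑ k : Fin n, (pd F k x / F x) * pd f k x)
          - ((n - 1 : ℝ) / (n - 2 : ℝ)) * (pd w i x) ^ 2)
        = x i ^ 2 * B n 𝓕 𝓯 𝔀 ‖x‖ + D n 𝓕 𝓯 ‖x‖
      ∧ (B n 𝓕 𝓯 𝔀 ‖x‖ = 0 →
          (((n - 2 : ℝ) * pd2 F i i x / F x + (∑ k : Fin n, pd2 F k k x / F x)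
              - (n - 1 : ℝ) * (∑ k : Fin n, (pd F k x) ^ 2 / (F x) ^ 2)
              + pd2 f i i x + 2 * (pd F i x / F x) * pd f i x
              - (∑ k : Fin n, (pd F k x / F x) * pd f k x)
              - ((n - 1 : ℝ) / (n - 2 : ℝ)) * (pd w i x) ^ 2) = lam / (F x) ^ 2
            ↔ D n 𝓕 𝓯 ‖x‖ = lam / (𝓕 ‖x‖) ^ 2)) := by
  intro x hx i
  have hne := h𝓕ne _ hx
  have hn2 : (n : ℝ) - 2 ≠ 0 := by
    have : (3 : ℝ) ≤ n := by exact_mod_cast hn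
    linarith
  have s1 : (∑ k : Fin n, pd2 F k k x / F x)
      = (deriv (deriv 𝓕) ‖x‖ + (n - 1) * deriv 𝓕 ‖x‖ / ‖x‖) / 𝓕 ‖x‖ := by
    rw [← Finset.sum_div, hF]
    simp only [pd2_radial 𝓕 h𝓕 F hF x hx]
    rw [Finset.sum_add_distrib, ← Finset.sum_mul, sum_sq_norm]
    simp
    field_simp
    ring
  have s2 : (∑ k : Fin n, (pd F k x) ^ 2 / (F x) ^ 2) = (deriv 𝓕 ‖x‖ / 𝓕 ‖x‖) ^ 2 := by
    rw [← Finset.sum_div, hF]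
    simp only [pd_radial 𝓕 h𝓕 F hF x hx, mul_pow]
    rw [← Finset.mul_sum, ← Finset.mul_sum, sum_sq_norm]
    field_simp
  have s3 : (∑ k : Fin n, (pd F k x / F x) * pd f k x)
      = (deriv 𝓕 ‖x‖ / 𝓕 ‖x‖) * deriv 𝓯 ‖x‖ := by
    have : ∀ k : Fin n, (pd F k x / F x) * pd f k x
        = (deriv 𝓕 ‖x‖ / 𝓕 ‖x‖) * deriv 𝓯 ‖x‖ * (‖x‖⁻¹) ^ 2 * x k ^ 2 := by
      intro k
      rw [pd_radial 𝓕 h𝓕 F hF x hx, pd_radial 𝓯 h𝓯 f hf x hx, hF]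
      ring
    simp only [this]
    rw [← Finset.mul_sum, sum_sq_norm]
    field_simp
  rw [s1, s2, s3, pd2_radial 𝓕 h𝓕 F hF x hx, pd2_radial 𝓯 h𝓯 f hf x hx,
    pd_radial 𝓕 h𝓕 F hF x hx, pd_radial 𝓯 h𝓯 f hf x hx, pd_radial 𝔀 h𝔀 w hw x hx, hF]
  rw [and_iff_left_of_imp]
  · unfold B D
    field_simp
    ring
  · intro key hB
    rw [key, hB, mul_zero, zero_add]
end

section
/- (Proposition on radial soliton parameter functions.) Under the radial gradient extended Ricci soliton coordinate setting, the following are equivalent: (I) for every x ∈ ℝⁿ with x ≠ 0, the off-diagonal soliton equation holds at x for all i ≠ j, the diagonal soliton equation holds at x for every i, and the w-equation holds at x; (II) for every r > 0 the following three ODEs hold: (a) ((n−2)/𝔉(r))·( 𝔉''(r)/r² − 𝔉'(r)/r³ ) + 𝔣''(r)/r² − 𝔣'(r)/r³ + 2𝔉'(r)𝔣'(r)/(𝔉(r)r²) − αₙ(𝔴'(r))²/r² = 0; (b) (2n−3)𝔉'(r)/(r𝔉(r)) + 𝔣'(r)/r + 𝔉''(r)/𝔉(r) − (n−1)(𝔉'(r)/𝔉(r))²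 − (𝔉'(r)/𝔉(r))𝔣'(r) = λ/𝔉(r)²; (c) 𝔴''(r) + ( (n−1)/r − (n−2)𝔉'(r)/𝔉(r) − 𝔣'(r) )𝔴'(r) = 0. -/
lemma aux_norm_hasFDerivAt {n : ℕ} (x : EuclideanSpace ℝ (Fin n)) (hx : x ≠ 0) :
    HasFDerivAt (fun y : EuclideanSpace ℝ (Fin n) => ‖y‖) (‖x‖⁻¹ • innerSL ℝ x) x := by
  have h1 : HasFDerivAt (fun y : EuclideanSpace ℝ (Fin n) => ‖y‖ ^ 2) (2 • innerSL ℝ x) x :=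
    (hasStrictFDerivAt_norm_sq x).hasFDerivAt
  have hr : ‖x‖ ≠ 0 := norm_ne_zero_iff.mpr hx
  have h2 := h1.sqrt (pow_ne_zero 2 hr)
  have h3 : (fun y : EuclideanSpace ℝ (Fin n) => ‖y‖) = fun y => Real.sqrt (‖y‖ ^ 2) := by
    funext y
    rw [Real.sqrt_sq (norm_nonneg y)]
  rw [h3]
  have h4 : ‖x‖⁻¹ • innerSL ℝ x = (1 / (2 * Real.sqrt (‖x‖ ^ 2))) • 2 • innerSL ℝ x := by
    ext v
    rw [Real.sqrt_sq (norm_nonneg x)]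
    simp
    field_simp
  rw [h4]
  exact h2

lemma aux_comp {n : ℕ} (φ : ℝ → ℝ) (x : EuclideanSpace ℝ (Fin n)) (hx : x ≠ 0)
    (hφ : DifferentiableAt ℝ φ ‖x‖) :
    HasFDerivAt (fun y : EuclideanSpace ℝ (Fin n) => φ ‖y‖)
      (deriv φ ‖x‖ • (‖x‖⁻¹ • innerSL ℝ x)) x :=
  hφ.hasDerivAt.comp_hasFDerivAt x (aux_norm_hasFDerivAt x hx)

lemma aux_pd {n : ℕ} (φ : ℝ → ℝ) (x : EuclideanSpace ℝ (Fin n)) (hx : x ≠ 0)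
    (hφ : DifferentiableAt ℝ φ ‖x‖) (i : Fin n) :
    pd (fun y : EuclideanSpace ℝ (Fin n) => φ ‖y‖) i x = deriv φ ‖x‖ / ‖x‖ * x i := by
  unfold pd
  rw [(aux_comp φ x hx hφ).fderiv]
  simp [EuclideanSpace.inner_single_right]
  ring

lemma aux_pd2 {n : ℕ} (φ : ℝ → ℝ) (hφ : ContDiff ℝ 2 φ)
    (x : EuclideanSpace ℝ (Fin n)) (hx : x ≠ 0) (i j : Fin n) :
    pd2 (fun y : EuclideanSpace ℝ (Fin n) => φ ‖y‖) i j x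
      = (deriv (deriv φ) ‖x‖ / ‖x‖ ^ 2 - deriv φ ‖x‖ / ‖x‖ ^ 3) * x i * x j
        + (if i = j then deriv φ ‖x‖ / ‖x‖ else 0) := by
  have hr : ‖x‖ ≠ 0 := norm_ne_zero_iff.mpr hx
  have hd : Differentiable ℝ φ := hφ.differentiable (by norm_num)
  have hφ1 : ContDiff ℝ 1 (deriv φ) := by
    have : ContDiff ℝ (1 + 1) φ := by simpa [one_add_one_eq_two] using hφ
    exact (contDiff_succ_iff_deriv.mp this).2.2
  have hd1 : Differentiable ℝ (deriv φ) := hφ1.differentiable (by norm_num)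
  have hev : pd (fun y : EuclideanSpace ℝ (Fin n) => φ ‖y‖) i =ᶠ[nhds x]
      fun y => (fun r => deriv φ r / r) ‖y‖ * y i := by
    filter_upwards [isOpen_ne.mem_nhds hx] with y hy
    exact aux_pd φ y hy (hd _) i
  have hψ : HasDerivAt (fun r => deriv φ r / r)
      ((deriv (deriv φ) ‖x‖ * ‖x‖ - deriv φ ‖x‖ * 1) / ‖x‖ ^ 2) ‖x‖ :=
    (hd1 _).hasDerivAt.div (hasDerivAt_id _) hr
  have h1 := aux_comp (fun r => deriv φ r / r) x hx hψ.differentiableAt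
  have h2 : HasFDerivAt (fun y : EuclideanSpace ℝ (Fin n) => y i)
      (EuclideanSpace.proj i : EuclideanSpace ℝ (Fin n) →L[ℝ] ℝ) x :=
    (EuclideanSpace.proj i : EuclideanSpace ℝ (Fin n) →L[ℝ] ℝ).hasFDerivAt
  have h3 := h1.mul h2
  have h4 := h3.congr_of_eventuallyEq hev
  rw [pd2, pd, h4.fderiv, hψ.deriv]
  by_cases hij : i = j
  · subst hij
    simp [EuclideanSpace.inner_single_right]
    field_simp
    ring
  · simp [EuclideanSpace.inner_single_right, hij]
    field_simp

lemma aux_sum {n : ℕ} (x : EuclideanSpace ℝ (Fin n)) : ∑ k, x k * x k = ‖x‖ ^ 2 := by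
  rw [EuclideanSpace.real_norm_sq_eq]
  simp [sq]

noncomputable def odeA (n : ℕ) (𝓕 𝓯 𝔀 : ℝ → ℝ) (r : ℝ) : ℝ :=
  (((n - 2 : ℝ) / 𝓕 r) * (deriv (deriv 𝓕) r / r ^ 2 - deriv 𝓕 r / r ^ 3)
          + deriv (deriv 𝓯) r / r ^ 2 - deriv 𝓯 r / r ^ 3
          + 2 * deriv 𝓕 r * deriv 𝓯 r / (𝓕 r * r ^ 2)
          - ((n - 1 : ℝ) / (n - 2 : ℝ)) * (deriv 𝔀 r) ^ 2 / r ^ 2)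

noncomputable def odeB (n : ℕ) (lam : ℝ) (𝓕 𝓯 : ℝ → ℝ) (r : ℝ) : ℝ :=
  ((2 * n - 3 : ℝ) * deriv 𝓕 r / (r * 𝓕 r) + deriv 𝓯 r / r
          + deriv (deriv 𝓕) r / 𝓕 r - (n - 1 : ℝ) * (deriv 𝓕 r / 𝓕 r) ^ 2
          - (deriv 𝓕 r / 𝓕 r) * deriv 𝓯 r) - lam / (𝓕 r) ^ 2

noncomputable def odeC (n : ℕ) (𝓕 𝓯 𝔀 : ℝ → ℝ) (r : ℝ) : ℝ :=
  deriv (deriv 𝔀) r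
          + ((n - 1 : ℝ) / r - (n - 2 : ℝ) * deriv 𝓕 r / 𝓕 r - deriv 𝓯 r) * deriv 𝔀 r

lemma aux_key (n : ℕ) (lam : ℝ) (𝓕 𝓯 𝔀 : ℝ → ℝ)
    (h𝓕 : ContDiff ℝ 2 𝓕) (h𝓯 : ContDiff ℝ 2 𝓯) (h𝔀 : ContDiff ℝ 2 𝔀)
    (x : EuclideanSpace ℝ (Fin n)) (hx : x ≠ 0) (hne : 𝓕 ‖x‖ ≠ 0) :
    let F : EuclideanSpace ℝ (Fin n) → ℝ := fun x => 𝓕 ‖x‖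
    let f : EuclideanSpace ℝ (Fin n) → ℝ := fun x => 𝓯 ‖x‖
    let w : EuclideanSpace ℝ (Fin n) → ℝ := fun x => 𝔀 ‖x‖
    (∀ i j : Fin n, i ≠ j →
      (n - 2 : ℝ) * pd2 F i j x / F x + pd2 f i j x
          + (pd F j x / F x) * pd f i x + (pd F i x / F x) * pd f j x
          - ((n - 1 : ℝ) / (n - 2 : ℝ)) * pd w i x * pd w j x
        = odeA n 𝓕 𝓯 𝔀 ‖x‖ * (x i * x j))
    ∧ (∀ i : Fin n,
      (n - 2 : ℝ) * pd2 F i i x / F x + (∑ k : Fin n, pd2 F k k x / F x)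
          - (n - 1 : ℝ) * (∑ k : Fin n, (pd F k x) ^ 2 / (F x) ^ 2)
          + pd2 f i i x + 2 * (pd F i x / F x) * pd f i x
          - (∑ k : Fin n, (pd F k x / F x) * pd f k x)
          - ((n - 1 : ℝ) / (n - 2 : ℝ)) * (pd w i x) ^ 2 - lam / (F x) ^ 2
        = odeA n 𝓕 𝓯 𝔀 ‖x‖ * (x i * x i) + odeB n lam 𝓕 𝓯 ‖x‖)
    ∧ ((∑ k : Fin n, pd2 w k k x)
          + (2 - n : ℝ) * (∑ k : Fin n, (pd F k x / F x) * pd w k x)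
        - (∑ k : Fin n, pd f k x * pd w k x) = odeC n 𝓕 𝓯 𝔀 ‖x‖) := by
  intro F f w
  have hr : ‖x‖ ≠ 0 := norm_ne_zero_iff.mpr hx
  have hs := aux_sum x
  have pF : ∀ i, pd F i x = deriv 𝓕 ‖x‖ / ‖x‖ * x i :=
    aux_pd 𝓕 x hx (h𝓕.differentiable (by norm_num) _)
  have pf : ∀ i, pd f i x = deriv 𝓯 ‖x‖ / ‖x‖ * x i :=
    aux_pd 𝓯 x hx (h𝓯.differentiable (by norm_num) _)
  have pw : ∀ i, pd w i x = deriv 𝔀 ‖x‖ / ‖x‖ * x i :=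
    aux_pd 𝔀 x hx (h𝔀.differentiable (by norm_num) _)
  have pF2 := aux_pd2 𝓕 h𝓕 x hx
  have pf2 := aux_pd2 𝓯 h𝓯 x hx
  have pw2 := aux_pd2 𝔀 h𝔀 x hx
  have hFx : F x = 𝓕 ‖x‖ := rfl
  change ∀ i j, pd2 F i j x = _ at pF2
  change ∀ i j, pd2 f i j x = _ at pf2
  change ∀ i j, pd2 w i j x = _ at pw2
  -- a sum of multiples of `x k * x k`
  have hsum : ∀ c : ℝ, ∑ k : Fin n, c * (x k * x k) = c * ‖x‖ ^ 2 := by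
    intro c
    rw [← Finset.mul_sum, hs]
  have hsum2 : ∀ c d : ℝ, ∑ k : Fin n, (c * (x k * x k) + d) = c * ‖x‖ ^ 2 + n * d := by
    intro c d
    rw [Finset.sum_add_distrib, hsum]
    simp
  have s1 : (∑ k : Fin n, pd2 F k k x / F x)
      = (deriv (deriv 𝓕) ‖x‖ / ‖x‖ ^ 2 - deriv 𝓕 ‖x‖ / ‖x‖ ^ 3) / 𝓕 ‖x‖ * ‖x‖ ^ 2
        + n * (deriv 𝓕 ‖x‖ / ‖x‖ / 𝓕 ‖x‖) := by
    rw [← hsum2]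
    refine Finset.sum_congr rfl fun k _ => ?_
    rw [pF2, if_pos rfl, hFx]; ring
  have s2 : (∑ k : Fin n, (pd F k x) ^ 2 / (F x) ^ 2)
      = (deriv 𝓕 ‖x‖ / ‖x‖) ^ 2 / 𝓕 ‖x‖ ^ 2 * ‖x‖ ^ 2 := by
    rw [← hsum]
    refine Finset.sum_congr rfl fun k _ => ?_
    rw [pF, hFx]; ring
  have s3 : (∑ k : Fin n, (pd F k x / F x) * pd f k x)
      = (deriv 𝓕 ‖x‖ / ‖x‖) / 𝓕 ‖x‖ * (deriv 𝓯 ‖x‖ / ‖x‖) * ‖x‖ ^ 2 := by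
    rw [← hsum]
    refine Finset.sum_congr rfl fun k _ => ?_
    rw [pF, pf, hFx]; ring
  have s4 : (∑ k : Fin n, (pd F k x / F x) * pd w k x)
      = (deriv 𝓕 ‖x‖ / ‖x‖) / 𝓕 ‖x‖ * (deriv 𝔀 ‖x‖ / ‖x‖) * ‖x‖ ^ 2 := by
    rw [← hsum]
    refine Finset.sum_congr rfl fun k _ => ?_
    rw [pF, pw, hFx]; ring
  have s5 : (∑ k : Fin n, pd f k x * pd w k x)
      = (deriv 𝓯 ‖x‖ / ‖x‖) * (deriv 𝔀 ‖x‖ / ‖x‖) * ‖x‖ ^ 2 := by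
    rw [← hsum]
    refine Finset.sum_congr rfl fun k _ => ?_
    rw [pf, pw]; ring
  have s6 : (∑ k : Fin n, pd2 w k k x)
      = (deriv (deriv 𝔀) ‖x‖ / ‖x‖ ^ 2 - deriv 𝔀 ‖x‖ / ‖x‖ ^ 3) * ‖x‖ ^ 2
        + n * (deriv 𝔀 ‖x‖ / ‖x‖) := by
    rw [← hsum2]
    refine Finset.sum_congr rfl fun k _ => ?_
    rw [pw2, if_pos rfl]; ring
  refine ⟨fun i j hij => ?_, fun i => ?_, ?_⟩
  · rw [pF2, pf2, pF, pF, pf, pf, pw, pw, hFx, if_neg hij, if_neg hij, odeA]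
    generalize ((n : ℝ) - 1) / ((n : ℝ) - 2) = α
    field_simp
    ring
  · rw [s1, s2, s3, pF2, pf2, pF, pf, pw, hFx, if_pos rfl, if_pos rfl, odeA, odeB]
    generalize ((n : ℝ) - 1) / ((n : ℝ) - 2) = α
    field_simp
    ring
  · rw [s4, s5, s6, odeC]
    field_simp
    ring

/-- equivalence of the coordinate soliton equations and the radial ODEs. -/
theorem radial_soliton_iff_ODEs (n : ℕ) (hn : 3 ≤ n) (lam : ℝ) (𝓕 𝓯 𝔀 : ℝ → ℝ)
    (h𝓕 : ContDiff ℝ 2 𝓕) (h𝓯 : ContDiff ℝ 2 𝓯) (h𝔀 : ContDiff ℝ 2 𝔀)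
    (h𝓕ne : ∀ r : ℝ, 0 < r → 𝓕 r ≠ 0)
    (F f w : EuclideanSpace ℝ (Fin n) → ℝ)
    (hF : ∀ x, F x = 𝓕 ‖x‖) (hf : ∀ x, f x = 𝓯 ‖x‖) (hw : ∀ x, w x = 𝔀 ‖x‖) :
    (∀ (x : EuclideanSpace ℝ (Fin n)), x ≠ 0 →
      (∀ i j : Fin n, i ≠ j →
        (n - 2 : ℝ) * pd2 F i j x / F x + pd2 f i j x
          + (pd F j x / F x) * pd f i x + (pd F i x / F x) * pd f j x
          - ((n - 1 : ℝ) / (n - 2 : ℝ)) * pd w i x * pd w j x = 0)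
      ∧ (∀ i : Fin n,
        (n - 2 : ℝ) * pd2 F i i x / F x + (∑ k : Fin n, pd2 F k k x / F x)
          - (n - 1 : ℝ) * (∑ k : Fin n, (pd F k x) ^ 2 / (F x) ^ 2)
          + pd2 f i i x + 2 * (pd F i x / F x) * pd f i x
          - (∑ k : Fin n, (pd F k x / F x) * pd f k x)
          - ((n - 1 : ℝ) / (n - 2 : ℝ)) * (pd w i x) ^ 2 = lam / (F x) ^ 2)
      ∧ ((∑ k : Fin n, pd2 w k k x)
          + (2 - n : ℝ) * (∑ k : Fin n, (pd F k x / F x) * pd w k x)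
          = (∑ k : Fin n, pd f k x * pd w k x)))
    ↔
    (∀ r : ℝ, 0 < r →
      (((n - 2 : ℝ) / 𝓕 r) * (deriv (deriv 𝓕) r / r ^ 2 - deriv 𝓕 r / r ^ 3)
          + deriv (deriv 𝓯) r / r ^ 2 - deriv 𝓯 r / r ^ 3
          + 2 * deriv 𝓕 r * deriv 𝓯 r / (𝓕 r * r ^ 2)
          - ((n - 1 : ℝ) / (n - 2 : ℝ)) * (deriv 𝔀 r) ^ 2 / r ^ 2 = 0)
      ∧ ((2 * n - 3 : ℝ) * deriv 𝓕 r / (r * 𝓕 r) + deriv 𝓯 r / r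
          + deriv (deriv 𝓕) r / 𝓕 r - (n - 1 : ℝ) * (deriv 𝓕 r / 𝓕 r) ^ 2
          - (deriv 𝓕 r / 𝓕 r) * deriv 𝓯 r = lam / (𝓕 r) ^ 2)
      ∧ (deriv (deriv 𝔀) r
          + ((n - 1 : ℝ) / r - (n - 2 : ℝ) * deriv 𝓕 r / 𝓕 r - deriv 𝓯 r) * deriv 𝔀 r
          = 0)) := by
  obtain rfl : F = fun x => 𝓕 ‖x‖ := funext hF
  obtain rfl : f = fun x => 𝓯 ‖x‖ := funext hf
  obtain rfl : w = fun x => 𝔀 ‖x‖ := funext hw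
  have hn2 : (n : ℝ) - 2 ≠ 0 := by
    have : (3 : ℝ) ≤ n := by exact_mod_cast hn
    linarith
  have key : ∀ x : EuclideanSpace ℝ (Fin n), x ≠ 0 → _ :=
    fun x hx => aux_key n lam 𝓕 𝓯 𝔀 h𝓕 h𝓯 h𝔀 x hx (h𝓕ne _ (norm_pos_iff.mpr hx))
  constructor
  · intro H r hr
    let i0 : Fin n := ⟨0, by omega⟩
    let i1 : Fin n := ⟨1, by omega⟩
    have h01 : i1 ≠ i0 := by simp [i0, i1]
    have hxn : ‖(EuclideanSpace.single i0 r : EuclideanSpace ℝ (Fin n))‖ = r := by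
      simp [abs_of_pos hr]
    have hx : (EuclideanSpace.single i0 r : EuclideanSpace ℝ (Fin n)) ≠ 0 := by
      rw [← norm_pos_iff, hxn]; exact hr
    obtain ⟨_, k2, k3⟩ := key _ hx
    obtain ⟨_, H2, H3⟩ := H _ hx
    have e0 := (k2 i0).symm.trans (sub_eq_zero.mpr (H2 i0))
    have e1 := (k2 i1).symm.trans (sub_eq_zero.mpr (H2 i1))
    have e3 := k3.symm.trans (sub_eq_zero.mpr H3)
    have v0 : (EuclideanSpace.single i0 r : EuclideanSpace ℝ (Fin n)) i0 = r := by simp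
    have v1 : (EuclideanSpace.single i0 r : EuclideanSpace ℝ (Fin n)) i1 = 0 := by
      simp [h01]
    rw [hxn, v0] at e0
    rw [hxn, v1] at e1
    rw [hxn] at e3
    have hB : odeB n lam 𝓕 𝓯 r = 0 := by linarith
    refine ⟨?_, sub_eq_zero.mp hB, e3⟩
    have : odeA n 𝓕 𝓯 𝔀 r * (r * r) = 0 := by linarith
    exact (mul_eq_zero.mp this).resolve_right (by positivity)
  · intro H x hx
    obtain ⟨k1, k2, k3⟩ := key x hx
    obtain ⟨a, b, c⟩ := H ‖x‖ (norm_pos_iff.mpr hx)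
    have ha0 : odeA n 𝓕 𝓯 𝔀 ‖x‖ = 0 := a
    have hb0 : odeB n lam 𝓕 𝓯 ‖x‖ = 0 := sub_eq_zero.mpr b
    have hc0 : odeC n 𝓕 𝓯 𝔀 ‖x‖ = 0 := c
    refine ⟨fun i j hij => ?_, fun i => ?_, ?_⟩
    · rw [k1 i j hij, ha0, zero_mul]
    · rw [← sub_eq_zero, k2 i, ha0, hb0, zero_mul, zero_add]
    · rw [← sub_eq_zero, k3, hc0]
end
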